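/- Suppose the quadratic form x ↦ ⟨x, T x⟩ is a Legendre form, the only v ∈ 0⁺F with ⟨v, T v⟩ = 0 is v = 0, the constraint set F is nonempty, and f is bounded from below on F. Then f attains its infimum on F. -/

import Mathlib

open scoped RealInnerProductSpace
open Filter Topology

/-- A sequence `x` in a real inner product space converges weakly to `x₀` if
`⟪a, x k⟫ → ⟪a, x₀⟫` for every `a`. -/
def WeaklyConvergesTo {H : Type*} [NormedAddCommGroup H] [InnerProductSpace ℝ H]
    (x : ℕ → H) (x₀ : H) : Prop :=
  ∀ a : H, Tendsto (fun k => ⟪a, x k⟫) atTop (𝓝 ⟪a, x₀⟫)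

/-- The quadratic form `x ↦ ⟪x, T x⟫` is a Legendre form: it is weakly sequentially lower
semicontinuous, and `x k → x₀` strongly whenever `x k ⇀ x₀` and `⟪x k, T (x k)⟫ → ⟪x₀, T x₀⟫`. -/
def IsLegendreForm {H : Type*} [NormedAddCommGroup H] [InnerProductSpace ℝ H]
    (T : H →L[ℝ] H) : Prop :=
  (∀ (x : ℕ → H) (x₀ : H), WeaklyConvergesTo x x₀ →
      ⟪x₀, T x₀⟫ ≤ Filter.liminf (fun k => ⟪x k, T (x k)⟫) Filter.atTop) ∧
  (∀ (x : ℕ → H) (x₀ : H), WeaklyConvergesTo x x₀ →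
      Tendsto (fun k => ⟪x k, T (x k)⟫) atTop (𝓝 ⟪x₀, T x₀⟫) →
      Tendsto x atTop (𝓝 x₀))

/-- The recession cone `0⁺X = {v | x + t • v ∈ X for all x ∈ X and t ≥ 0}`. -/
def recessionCone {H : Type*} [NormedAddCommGroup H] [InnerProductSpace ℝ H]
    (X : Set H) : Set H :=
  {v | ∀ x ∈ X, ∀ t : ℝ, 0 ≤ t → x + t • v ∈ X}

/-- A bounded sequence in a Hilbert space has a weakly convergent subsequence. -/
theorem exists_subseq_weaklyConvergesTo
    {H : Type*} [NormedAddCommGroup H] [InnerProductSpace ℝ H] [CompleteSpace H]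
    {x : ℕ → H} {R : ℝ} (hx : ∀ k, ‖x k‖ ≤ R) :
    ∃ (x₀ : H) (φ : ℕ → ℕ), StrictMono φ ∧ WeaklyConvergesTo (x ∘ φ) x₀ := by
  let K : Submodule ℝ H := (Submodule.span ℝ (Set.range x)).topologicalClosure
  have hxK : ∀ k, x k ∈ K := fun k =>
    Submodule.le_topologicalClosure _ (Submodule.subset_span (Set.mem_range_self k))
  have hsep : TopologicalSpace.IsSeparable (K : Set H) :=
    (Set.countable_range x).isSeparable.span.closure
  have : TopologicalSpace.SeparableSpace K := hsep.separableSpace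
  have : CompleteSpace K :=
    (Submodule.isClosed_topologicalClosure _).completeSpace_coe
  let y : ℕ → K := fun k => ⟨x k, hxK k⟩
  obtain ⟨ψ, -, φ, hφ, hlim⟩ := WeakDual.isSeqCompact_closedBall ℝ K 0 R
    (x := fun k => StrongDual.toWeakDual (InnerProductSpace.toDual ℝ K (y k))) (fun k => by
      change InnerProductSpace.toDual ℝ K (y k) ∈ Metric.closedBall 0 R
      rw [mem_closedBall_zero_iff, LinearIsometryEquiv.norm_map]
      exact hx k)
  let z : K := (InnerProductSpace.toDual ℝ K).symm (WeakDual.toStrongDual ψ)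
  refine ⟨z, φ, hφ, fun a => ?_⟩
  have hinner : ∀ w : K, ⟪a, (w : H)⟫ = ⟪w, K.orthogonalProjectionOnto a⟫ := fun w => by
    rw [real_inner_comm, K.inner_orthogonalProjectionOnto_eq_of_mem_left]
  have hz : ⟪z, K.orthogonalProjectionOnto a⟫ = ψ (K.orthogonalProjectionOnto a) :=
    InnerProductSpace.toDual_symm_apply
  have heval := ((WeakDual.eval_continuous (K.orthogonalProjectionOnto a)).tendsto ψ).comp hlim
  rw [hinner z, hz]
  refine heval.congr fun k => ?_
  exact (hinner (y (φ k))).symm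

section QuadraticForms

variable {H : Type*} [NormedAddCommGroup H] [InnerProductSpace ℝ H]

theorem inner_add_smul_map_add_smul {T : H →L[ℝ] H} (hT : ∀ x y : H, ⟪T x, y⟫ = ⟪x, T y⟫)
    (x v : H) (t : ℝ) :
    ⟪x + t • v, T (x + t • v)⟫ = ⟪x, T x⟫ + 2 * t * ⟪T v, x⟫ + t ^ 2 * ⟪v, T v⟫ := by
  have h : ⟪v, T x⟫ = ⟪T v, x⟫ := (hT v x).symm
  have h' : ⟪x, T v⟫ = ⟪T v, x⟫ := real_inner_comm _ _
  simp only [map_add, map_smul, inner_add_left, inner_add_right, real_inner_smul_left,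
    real_inner_smul_right, h, h']
  ring

theorem inner_smul_map_smul (T : H →L[ℝ] H) (x : H) (t : ℝ) :
    ⟪t • x, T (t • x)⟫ = t ^ 2 * ⟪x, T x⟫ := by
  simp only [map_smul, real_inner_smul_left, real_inner_smul_right]
  ring

/-- Convex quadratic inequalities pass to weak limits. -/
theorem WeaklyConvergesTo.half_inner_map_add_nonpos {T : H →L[ℝ] H}
    (hT : ∀ x y : H, ⟪T x, y⟫ = ⟪x, T y⟫) (hpos : ∀ x : H, 0 ≤ ⟪x, T x⟫)
    {x : ℕ → H} {x₀ : H} (hx : WeaklyConvergesTo x x₀) {r : ℕ → ℝ} {r₀ : ℝ}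
    (hr : Tendsto r atTop (𝓝 r₀)) (hle : ∀ k, (1 / 2 : ℝ) * ⟪x k, T (x k)⟫ + r k ≤ 0) :
    (1 / 2 : ℝ) * ⟪x₀, T x₀⟫ + r₀ ≤ 0 := by
  have hlim := ((hx (T x₀)).sub_const ((1 / 2 : ℝ) * ⟪x₀, T x₀⟫)).add hr
  have hbound := le_of_tendsto' (b := (0 : ℝ)) hlim fun k => by
    have h := hpos (x k + (-1 : ℝ) • x₀)
    rw [inner_add_smul_map_add_smul hT] at h
    linarith [hle k]
  rw [hT x₀ x₀] at hbound
  linarith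

/-- A vector on which a positive semidefinite form is nonpositive lies in its kernel. -/
theorem inner_map_eq_zero_of_nonpos {T : H →L[ℝ] H}
    (hT : ∀ x y : H, ⟪T x, y⟫ = ⟪x, T y⟫) (hpos : ∀ x : H, 0 ≤ ⟪x, T x⟫)
    {v : H} (hv : ⟪v, T v⟫ ≤ 0) (x : H) : ⟪T v, x⟫ = 0 := by
  have hv0 : ⟪v, T v⟫ = 0 := le_antisymm hv (hpos v)
  by_contra hne
  have h := hpos (x + (-(⟪x, T x⟫ + 1) / (2 * ⟪T v, x⟫)) • v)
  rw [inner_add_smul_map_add_smul hT, hv0] at h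
  have h2 : 2 * (-(⟪x, T x⟫ + 1) / (2 * ⟪T v, x⟫)) * ⟪T v, x⟫ = -(⟪x, T x⟫ + 1) := by
    field_simp
  rw [h2] at h
  linarith

theorem IsLegendreForm.inner_map_le_of_tendsto {T : H →L[ℝ] H} (hT : IsLegendreForm T)
    {x : ℕ → H} {x₀ : H} (hx : WeaklyConvergesTo x x₀) {L : ℝ}
    (hL : Tendsto (fun k => ⟪x k, T (x k)⟫) atTop (𝓝 L)) : ⟪x₀, T x₀⟫ ≤ L :=
  hL.liminf_eq ▸ hT.1 x x₀ hx

/-- A polynomial of degree at most two bounded from below on `[0, ∞)` has nonnegative leading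
coefficient. -/
theorem leadingCoeff_nonneg_of_bddBelow {a b B : ℝ} (h : ∀ t : ℝ, 0 ≤ t → B ≤ b * t + a * t ^ 2) :
    0 ≤ a := by
  have hinv := tendsto_inv_atTop_zero (𝕜 := ℝ)
  have hlim : Tendsto (fun t : ℝ => B * t⁻¹ ^ 2 - b * t⁻¹) atTop (𝓝 0) := by
    simpa using ((hinv.pow 2).const_mul B).sub (hinv.const_mul b)
  refine le_of_tendsto hlim ?_
  filter_upwards [eventually_gt_atTop (0 : ℝ)] with t ht
  have h1 := mul_le_mul_of_nonneg_right (h t ht.le) (sq_nonneg t⁻¹)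
  have h2 : (b * t + a * t ^ 2) * t⁻¹ ^ 2 = b * t⁻¹ + a := by field_simp
  linarith

/-- A vector along which every convex quadratic constraint is asymptotically satisfied is a
recession direction of the constraint set. -/
theorem mem_recessionCone_of_forall {ι : Type*} {Ti : ι → H →L[ℝ] H}
    (hTi_sa : ∀ i, ∀ x y : H, ⟪Ti i x, y⟫ = ⟪x, Ti i y⟫)
    (hTi_pos : ∀ i, ∀ x : H, 0 ≤ ⟪x, Ti i x⟫) {ci : ι → H} {α : ι → ℝ} {v : H}
    (hv : ∀ i, ⟪v, Ti i v⟫ ≤ 0) (hcv : ∀ i, ⟪ci i, v⟫ ≤ 0) :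
    v ∈ recessionCone {x : H | ∀ i, (1 / 2 : ℝ) * ⟪x, Ti i x⟫ + ⟪ci i, x⟫ + α i ≤ 0} := by
  intro x hx t ht i
  rw [inner_add_smul_map_add_smul (hTi_sa i),
    inner_map_eq_zero_of_nonpos (hTi_sa i) (hTi_pos i) (hv i), inner_add_right,
    real_inner_smul_right]
  nlinarith [hx i, mul_nonneg (sq_nonneg t) (sub_nonneg.2 (hv i)),
    mul_nonneg ht (sub_nonneg.2 (hcv i))]

/-- If `x k` satisfies convex quadratic constraints, `‖x k‖ → ∞` and the normalized sequence
converges weakly, then the weak limit is a recession direction of the constraint set. -/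
theorem mem_recessionCone_of_weaklyConvergesTo {ι : Type*} {Ti : ι → H →L[ℝ] H}
    (hTi_sa : ∀ i, ∀ x y : H, ⟪Ti i x, y⟫ = ⟪x, Ti i y⟫)
    (hTi_pos : ∀ i, ∀ x : H, 0 ≤ ⟪x, Ti i x⟫) {ci : ι → H} {α : ι → ℝ} {x : ℕ → H} {v : H}
    (hx : ∀ k, x k ∈ {x : H | ∀ i, (1 / 2 : ℝ) * ⟪x, Ti i x⟫ + ⟪ci i, x⟫ + α i ≤ 0})
    (hnorm : Tendsto (fun k => ‖x k‖) atTop atTop)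
    (hv : WeaklyConvergesTo (fun k => ‖x k‖⁻¹ • x k) v) :
    v ∈ recessionCone {x : H | ∀ i, (1 / 2 : ℝ) * ⟪x, Ti i x⟫ + ⟪ci i, x⟫ + α i ≤ 0} := by
  have ht : Tendsto (fun k => ‖x k‖⁻¹) atTop (𝓝 0) := tendsto_inv_atTop_zero.comp hnorm
  refine mem_recessionCone_of_forall hTi_sa hTi_pos (fun i => ?_) (fun i => ?_)
  · have hr : Tendsto (fun k => ‖x k‖⁻¹ * ⟪ci i, ‖x k‖⁻¹ • x k⟫ + ‖x k‖⁻¹ ^ 2 * α i) atTop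
        (𝓝 0) := by
      simpa using (ht.mul (hv (ci i))).add ((ht.pow 2).mul_const (α i))
    have h := hv.half_inner_map_add_nonpos (hTi_sa i) (hTi_pos i) hr fun k => by
      rw [inner_smul_map_smul, real_inner_smul_right]
      nlinarith [mul_nonneg (sq_nonneg ‖x k‖⁻¹) (sub_nonneg.2 (hx k i))]
    linarith
  · have hr : Tendsto (fun k => -(‖x k‖⁻¹ * α i)) atTop (𝓝 0) := by
      simpa using (ht.mul_const (α i)).neg
    refine le_of_tendsto_of_tendsto' (hv (ci i)) hr fun k => ?_
    rw [real_inner_smul_right]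
    have h := mul_nonneg (inv_nonneg.2 (norm_nonneg (x k))) (sub_nonneg.2 (hx k i))
    have h' := mul_nonneg (inv_nonneg.2 (norm_nonneg (x k))) (hTi_pos i (x k))
    linarith

end QuadraticForms

/-- If `⟪x, T x⟫` is a Legendre form, the only `v ∈ 0⁺F` with `⟪v, T v⟫ = 0` is `v = 0`,
`F` is nonempty and `f` is bounded from below on `F`, then `f` attains its infimum on `F`. -/
theorem frank_wolfe_trivial_recession
    {H : Type*} [NormedAddCommGroup H] [InnerProductSpace ℝ H] [CompleteSpace H]
    {m : ℕ} (T : H →L[ℝ] H) (hT_sa : ∀ x y : H, ⟪T x, y⟫ = ⟪x, T y⟫) (c : H)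
    (Ti : Fin m → H →L[ℝ] H)
    (hTi_sa : ∀ i, ∀ x y : H, ⟪Ti i x, y⟫ = ⟪x, Ti i y⟫)
    (hTi_pos : ∀ i, ∀ x : H, 0 ≤ ⟪x, Ti i x⟫)
    (ci : Fin m → H) (α : Fin m → ℝ)
    (f : H → ℝ) (hf : ∀ x, f x = (1/2 : ℝ) * ⟪x, T x⟫ + ⟪c, x⟫)
    (F : Set H)
    (hF : F = {x : H | ∀ i, (1/2 : ℝ) * ⟪x, Ti i x⟫ + ⟪ci i, x⟫ + α i ≤ 0})
    (hLeg : IsLegendreForm T)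
    (hrec : ∀ v ∈ recessionCone F, ⟪v, T v⟫ = 0 → v = 0)
    (hne : F.Nonempty) (hbd : BddBelow (f '' F)) :
    ∃ xbar ∈ F, ∀ x ∈ F, f xbar ≤ f x := by
  subst hF
  obtain ⟨u, -, hu_lim, hu_mem⟩ := exists_seq_tendsto_sInf (hne.image f) hbd
  choose x hxF hfx using hu_mem
  have hlim := hu_lim.congr fun k => (hfx k).symm
  have hfreq : ∃ R : ℝ, ∃ᶠ k in atTop, ‖x k‖ ≤ R := by
    by_contra! hcon
    have hnorm : Tendsto (fun k => ‖x k‖) atTop atTop :=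
      tendsto_atTop.2 fun R => (hcon R).mono fun k hk => hk.le
    obtain ⟨v, φ, hφ, hv⟩ := exists_subseq_weaklyConvergesTo (x := fun k => ‖x k‖⁻¹ • x k)
      (R := 1) fun k => by
        rw [norm_smul, norm_inv, norm_norm]
        exact inv_mul_le_one
    replace hv : WeaklyConvergesTo (fun k => ‖x (φ k)‖⁻¹ • x (φ k)) v := hv
    have hnormφ : Tendsto (fun k => ‖x (φ k)‖) atTop atTop := hnorm.comp hφ.tendsto_atTop
    have ht : Tendsto (fun k => ‖x (φ k)‖⁻¹) atTop (𝓝 0) := tendsto_inv_atTop_zero.comp hnormφ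
    have hvrec := mem_recessionCone_of_weaklyConvergesTo hTi_sa hTi_pos
      (fun k => hxF (φ k)) hnormφ hv
    have hQ : Tendsto (fun k => ⟪‖x (φ k)‖⁻¹ • x (φ k), T (‖x (φ k)‖⁻¹ • x (φ k))⟫) atTop
        (𝓝 0) := by
      have h := (((ht.pow 2).mul (hlim.comp hφ.tendsto_atTop)).sub (ht.mul (hv c))).const_mul 2
      simp only [ne_eq, OfNat.ofNat_ne_zero, not_false_eq_true, zero_pow, zero_mul, sub_zero,
        mul_zero] at h
      refine h.congr fun k => ?_
      rw [inner_smul_map_smul, real_inner_smul_right, Function.comp_apply, hf]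
      ring
    have hQv_nonneg : 0 ≤ ⟪v, T v⟫ := by
      obtain ⟨y, hy⟩ := hne
      obtain ⟨B, hB⟩ := hbd
      have h := leadingCoeff_nonneg_of_bddBelow (a := (1 / 2 : ℝ) * ⟪v, T v⟫)
        (b := ⟪T v, y⟫ + ⟪c, v⟫) (B := B - f y) fun t ht0 => by
          have h := hB (Set.mem_image_of_mem f (hvrec y hy t ht0))
          rw [hf, inner_add_smul_map_add_smul hT_sa, inner_add_right, real_inner_smul_right] at h
          rw [hf y]
          linarith
      linarith
    have hQv : ⟪v, T v⟫ = 0 := le_antisymm (hLeg.inner_map_le_of_tendsto hv hQ) hQv_nonneg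
    have hstrong := (hLeg.2 _ v hv (by rwa [hQv])).norm
    rw [hrec v hvrec hQv, norm_zero] at hstrong
    refine zero_ne_one (tendsto_nhds_unique hstrong (tendsto_const_nhds.congr' ?_))
    filter_upwards [hnormφ.eventually_gt_atTop 0] with k hk
    rw [norm_smul, norm_inv, norm_norm, inv_mul_cancel₀ hk.ne']
  obtain ⟨R, hR⟩ := hfreq
  obtain ⟨σ, hσ, hσR⟩ := extraction_of_frequently_atTop hR
  obtain ⟨z, φ, hφ, hz⟩ := exists_subseq_weaklyConvergesTo (x := x ∘ σ) hσR
  have hlimz := hlim.comp (hσ.comp hφ).tendsto_atTop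
  refine ⟨z, fun i => ?_, fun y hy => ?_⟩
  · rw [add_assoc]
    exact hz.half_inner_map_add_nonpos (hTi_sa i) (hTi_pos i) ((hz (ci i)).add_const (α i))
      fun k => by
        rw [← add_assoc]
        exact hxF (σ (φ k)) i
  · have hQz := hLeg.inner_map_le_of_tendsto hz
      (((hlimz.sub (hz c)).const_mul 2).congr fun k => by
        simp only [Function.comp_apply, hf]
        ring)
    have hinf := csInf_le hbd (Set.mem_image_of_mem f hy)
    rw [hf z]
    linarith
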